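/- WZ-pair identity for Kummer's theorem: Let a, b be complex numbers and define, for nonnegative integers n and k, F(n,k) = [(a+2n)_k (b)_k (−1)^k / ((1+a+2n−b)_k k!)] · [Γ(1+a+2n) Γ(1+a/2+n−b) / (Γ(1+a/2+n) Γ(1+a+2n−b))] and G(n,k) = F(n,k) · C(n,k) with C(n,k) = −(b−1)k / ((1+a+2n−b+k)(a+2n)). Assume that for all nonnegative integers n and k the quantities a+2n, 1+a+2n−b+k are nonzero, 1+a+2n−b is not a nonpositive integer, and the Gamma factors are nonzero and finite. Then for all nonnegative integers n and k: F(n,k) − F(n+1,k) = G(n,k+1) − G(n,k). -/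

import Mathlib

open Complex Finset Filter Topology

/-- The Pochhammer symbol `(x)_k = x (x+1) ⋯ (x+k-1)`. -/
noncomputable def poch (x : ℂ) (k : ℕ) : ℂ := (ascPochhammer ℂ k).eval x

/-- The WZ summand for Kummer's theorem:
`F(n,k) = (a+2n)_k (b)_k (-1)^k / ((1+a+2n-b)_k k!) ·
  Γ(1+a+2n) Γ(1+a/2+n-b) / (Γ(1+a/2+n) Γ(1+a+2n-b))`. -/
noncomputable def kummerF (a b : ℂ) (n k : ℕ) : ℂ :=
  poch (a + 2 * n) k * poch b k * (-1 : ℂ) ^ k /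
    (poch (1 + a + 2 * n - b) k * (Nat.factorial k : ℂ)) *
  (Gamma (1 + a + 2 * n) * Gamma (1 + a / 2 + n - b) /
    (Gamma (1 + a / 2 + n) * Gamma (1 + a + 2 * n - b)))

/-- The WZ certificate `C(n,k) = -(b-1)k / ((1+a+2n-b+k)(a+2n))`. -/
noncomputable def kummerC (a b : ℂ) (n k : ℕ) : ℂ :=
  -((b - 1) * k) / ((1 + a + 2 * n - b + k) * (a + 2 * n))

/-- `G(n,k) = F(n,k) · C(n,k)`. -/
noncomputable def kummerG (a b : ℂ) (n k : ℕ) : ℂ :=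
  kummerF a b n k * kummerC a b n k

theorem poch_succ_right (x : ℂ) (k : ℕ) : poch x (k + 1) = poch x k * (x + k) := by
  simp [poch, ascPochhammer_succ_eval]

theorem poch_succ_left (x : ℂ) (k : ℕ) : poch x (k + 1) = x * poch (x + 1) k := by
  simp [poch, ascPochhammer_succ_left, Polynomial.eval_comp]

theorem poch_add_two (x : ℂ) (k : ℕ) :
    x * (x + 1) * poch (x + 2) k = poch x k * (x + k) * (x + k + 1) := by
  have h := poch_succ_left x (k + 1)
  rw [poch_succ_left (x + 1) k, poch_succ_right, poch_succ_right,
    show x + 1 + 1 = x + 2 by ring] at h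
  push_cast at h
  linear_combination -h

theorem poch_ne_zero {x : ℂ} (hx : ∀ k : ℕ, x + k ≠ 0) (k : ℕ) : poch x k ≠ 0 := by
  induction k with
  | zero => simp [poch]
  | succ k ih => rw [poch_succ_right]; exact mul_ne_zero ih (hx k)

theorem ne_zero_of_Gamma_ne_zero {x : ℂ} (hx : Gamma x ≠ 0) : x ≠ 0 := by
  rintro rfl
  exact hx Complex.Gamma_zero

theorem Gamma_add_two {x : ℂ} (hx : x ≠ 0) (hx1 : x + 1 ≠ 0) :
    Gamma (x + 2) = (x + 1) * x * Gamma x := by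
  rw [show x + 2 = x + 1 + 1 by ring, Complex.Gamma_add_one _ hx1, Complex.Gamma_add_one _ hx]
  ring

theorem kummerF_succ_right (a b : ℂ) (n k : ℕ) (hd : ∀ j : ℕ, 1 + a + 2 * (n : ℂ) - b + j ≠ 0) :
    kummerF a b n (k + 1) = -kummerF a b n k *
      ((a + 2 * n + k) * (b + k) / ((1 + a + 2 * n - b + k) * (k + 1))) := by
  have hp := poch_ne_zero hd k
  have hk := hd k
  have hf : (k.factorial : ℂ) ≠ 0 := by exact_mod_cast k.factorial_ne_zero
  have hk1 : (k : ℂ) + 1 ≠ 0 := by exact_mod_cast k.succ_ne_zero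
  unfold kummerF
  generalize Gamma (1 + a + 2 * n) * Gamma (1 + a / 2 + n - b) /
    (Gamma (1 + a / 2 + n) * Gamma (1 + a + 2 * n - b)) = g
  simp only [poch_succ_right, Nat.factorial_succ, pow_succ]
  push_cast
  field_simp

theorem kummerF_succ_left (a b : ℂ) (n k : ℕ) (h0 : a + 2 * (n : ℂ) ≠ 0)
    (hd : ∀ j : ℕ, 1 + a + 2 * (n : ℂ) - b + j ≠ 0)
    (h3 : Gamma (1 + a + 2 * (n : ℂ)) ≠ 0) (h4 : Gamma (1 + a / 2 + (n : ℂ) - b) ≠ 0)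
    (h5 : Gamma (1 + a / 2 + (n : ℂ)) ≠ 0) (h6 : Gamma (1 + a + 2 * (n : ℂ) - b) ≠ 0) :
    kummerF a b (n + 1) k = kummerF a b n k *
      ((a + 2 * n + k) * (a + 2 * n + k + 1) * (2 + a + 2 * n - 2 * b) /
        ((a + 2 * n) * (1 + a + 2 * n - b + k) * (2 + a + 2 * n - b + k))) := by
  have n3 := ne_zero_of_Gamma_ne_zero h3
  have n4 := ne_zero_of_Gamma_ne_zero h4
  have n5 := ne_zero_of_Gamma_ne_zero h5
  have n6 := ne_zero_of_Gamma_ne_zero h6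
  have hp := poch_ne_zero hd k
  have hf : (k.factorial : ℂ) ≠ 0 := by exact_mod_cast k.factorial_ne_zero
  have hk := hd k
  have hk1 := hd (k + 1)
  have hd1 := hd 1
  have hA := poch_add_two (a + 2 * n) k
  have hD := poch_add_two (1 + a + 2 * n - b) k
  have e3 : 1 + a + 2 * (n : ℂ) + 1 ≠ 0 := fun h => n5 (by linear_combination h / 2)
  have g3 := Gamma_add_two n3 e3
  have g4 := Complex.Gamma_add_one _ n4
  have g5 := Complex.Gamma_add_one _ n5
  push_cast at hk1 hd1
  have g6 := Gamma_add_two n6 hd1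
  unfold kummerF
  push_cast
  rw [show a + 2 * ((n : ℂ) + 1) = a + 2 * n + 2 by ring,
    show 1 + a + 2 * ((n : ℂ) + 1) = 1 + a + 2 * n + 2 by ring,
    show 1 + a + 2 * (n : ℂ) + 2 - b = 1 + a + 2 * n - b + 2 by ring,
    show 1 + a / 2 + ((n : ℂ) + 1) - b = 1 + a / 2 + n - b + 1 by ring,
    show 1 + a / 2 + ((n : ℂ) + 1) = 1 + a / 2 + n + 1 by ring, g3, g4, g5, g6]
  have hA1 : a + 2 * (n : ℂ) + 1 ≠ 0 := fun h => n3 (by linear_combination h)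
  have hA' : poch (a + 2 * n + 2) k = poch (a + 2 * n) k * (a + 2 * n + k) * (a + 2 * n + k + 1) /
      ((a + 2 * n) * (a + 2 * n + 1)) := by
    rw [eq_div_iff (mul_ne_zero h0 hA1)]; linear_combination hA
  have hD' : poch (1 + a + 2 * n - b + 2) k = poch (1 + a + 2 * n - b) k *
      (1 + a + 2 * n - b + k) * (1 + a + 2 * n - b + k + 1) /
      ((1 + a + 2 * n - b) * (1 + a + 2 * n - b + 1)) := by
    rw [eq_div_iff (mul_ne_zero n6 hd1)]; linear_combination hD
  rw [hA', hD']
  have c3 : 1 + a + 2 * (n : ℂ) = a + 2 * n + 1 := by ring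
  have c4 : 1 + a / 2 + (n : ℂ) - b = (2 + a + 2 * n - 2 * b) / 2 := by ring
  have c5 : 1 + a / 2 + (n : ℂ) = (a + 2 * n + 2) / 2 := by ring
  have ck : 2 + a + 2 * (n : ℂ) - b + k = 1 + a + 2 * n - b + k + 1 := by ring
  have hk1' : 1 + a + 2 * (n : ℂ) - b + k + 1 ≠ 0 := fun h => hk1 (by linear_combination h)
  rw [ck]
  generalize Gamma (1 + a + 2 * n) = G3 at *
  generalize Gamma (1 + a / 2 + n - b) = G4 at *
  generalize Gamma (1 + a / 2 + n) = G5 at *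
  generalize Gamma (1 + a + 2 * n - b) = G6 at *
  generalize poch (1 + a + 2 * n - b) k = P at *
  generalize poch (a + 2 * n) k = Q at *
  have e5 : a + 2 * (n : ℂ) + 2 ≠ 0 := fun h => e3 (by linear_combination h)
  rw [c4, c5]
  generalize hE : 1 + a + 2 * (n : ℂ) - b = E at *
  rw [c3, show a + 2 * (n : ℂ) + 1 + 1 = a + 2 * n + 2 by ring]
  generalize a + 2 * (n : ℂ) + 2 = A2 at *
  generalize a + 2 * (n : ℂ) + 1 = A1 at *
  generalize 2 + a + 2 * (n : ℂ) - 2 * b = B at *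
  generalize a + 2 * (n : ℂ) = A at *
  field_simp

/-- WZ-pair identity for Kummer's theorem:
`F(n,k) - F(n+1,k) = G(n,k+1) - G(n,k)`. -/
theorem kummer_WZ_pair (a b : ℂ)
    (h0 : ∀ n : ℕ, a + 2 * (n : ℂ) ≠ 0)
    (h1 : ∀ n k : ℕ, 1 + a + 2 * (n : ℂ) - b + (k : ℂ) ≠ 0)
    (h2 : ∀ n m : ℕ, 1 + a + 2 * (n : ℂ) - b ≠ -(m : ℂ))
    (h3 : ∀ n : ℕ, Gamma (1 + a + 2 * (n : ℂ)) ≠ 0)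
    (h4 : ∀ n : ℕ, Gamma (1 + a / 2 + (n : ℂ) - b) ≠ 0)
    (h5 : ∀ n : ℕ, Gamma (1 + a / 2 + (n : ℂ)) ≠ 0)
    (h6 : ∀ n : ℕ, Gamma (1 + a + 2 * (n : ℂ) - b) ≠ 0) :
    ∀ n k : ℕ,
      kummerF a b n k - kummerF a b (n + 1) k
        = kummerG a b n (k + 1) - kummerG a b n k := by
  intro n k
  have hk := h1 n k
  have hk1 := h1 n (k + 1)
  have hn := h0 n
  have hc : (k : ℂ) + 1 ≠ 0 := by exact_mod_cast k.succ_ne_zero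
  unfold kummerG
  rw [kummerF_succ_right a b n k (h1 n),
    kummerF_succ_left a b n k hn (h1 n) (h3 n) (h4 n) (h5 n) (h6 n)]
  unfold kummerC
  push_cast at hk1 ⊢
  have hk2 : 2 + a + 2 * (n : ℂ) - b + k ≠ 0 := fun h => hk1 (by linear_combination h)
  rw [show 1 + a + 2 * (n : ℂ) - b + (k + 1) = 2 + a + 2 * n - b + k by ring]
  field_simp
  ring
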